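/- The ADHM variety V(1,c) := {(A,B,I,J) : [A,B] + IJ = 0} with dim W = 1 and dim V = c ≥ 1 is reducible: the closure of the set of stable points (contained in {J = 0}) and the closed subset {I = 0} both have dimension 2c + c², so V(1,c) contains two distinct irreducible closed subsets of maximal dimension. -/

import Mathlib

/-- The Zariski topology on affine space ℂ^σ: generated by complements of hypersurfaces. -/
noncomputable def zarTop (σ : Type) : TopologicalSpace (σ → ℂ) :=
  TopologicalSpace.generateFrom
    {U | ∃ f : MvPolynomial σ ℂ, U = {x | MvPolynomial.eval x f ≠ 0}}

/-- Coordinates for the ADHM data space with r = 1: entries of A, B, I, J. -/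
abbrev AdhmCoord (c : ℕ) : Type :=
  (Fin c × Fin c) ⊕ ((Fin c × Fin c) ⊕ (Fin c ⊕ Fin c))

/-- The matrix A of a point. -/
def matA {c : ℕ} (x : AdhmCoord c → ℂ) : Matrix (Fin c) (Fin c) ℂ :=
  Matrix.of fun i j => x (Sum.inl (i, j))

/-- The matrix B of a point. -/
def matB {c : ℕ} (x : AdhmCoord c → ℂ) : Matrix (Fin c) (Fin c) ℂ :=
  Matrix.of fun i j => x (Sum.inr (Sum.inl (i, j)))

/-- The vector I of a point (a column vector, since dim W = 1). -/
def vecI {c : ℕ} (x : AdhmCoord c → ℂ) : Fin c → ℂ :=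
  fun i => x (Sum.inr (Sum.inr (Sum.inl i)))

/-- The vector J of a point (a row vector, since dim W = 1). -/
def vecJ {c : ℕ} (x : AdhmCoord c → ℂ) : Fin c → ℂ :=
  fun i => x (Sum.inr (Sum.inr (Sum.inr i)))

/-- The ADHM variety V(1,c): solutions of [A,B] + IJ = 0 with dim W = 1. -/
def adhmVariety (c : ℕ) : Set (AdhmCoord c → ℂ) :=
  {x | matA x * matB x - matB x * matA x + Matrix.vecMulVec (vecI x) (vecJ x) = 0}

/-- Stability of a point: no proper subspace of ℂ^c is A,B-invariant and contains I. -/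
def stablePt {c : ℕ} (x : AdhmCoord c → ℂ) : Prop :=
  ∀ S : Submodule ℂ (Fin c → ℂ),
    Submodule.map (matA x).mulVecLin S ≤ S →
    Submodule.map (matB x).mulVecLin S ≤ S →
    vecI x ∈ S → S = ⊤

section ZariskiTopology

attribute [local instance] zarTop

variable {σ τ : Type}

theorem zarTop_isTopologicalBasis :
    TopologicalSpace.IsTopologicalBasis
      {U : Set (σ → ℂ) | ∃ f : MvPolynomial σ ℂ, U = {x | MvPolynomial.eval x f ≠ 0}} := by
  have h := TopologicalSpace.isTopologicalBasis_of_subbasis_of_inter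
    (t := zarTop σ) (r := {U : Set (σ → ℂ) | ∃ f : MvPolynomial σ ℂ,
      U = {x | MvPolynomial.eval x f ≠ 0}}) rfl (by
    rintro _ ⟨f, rfl⟩ _ ⟨g, rfl⟩
    refine ⟨f * g, ?_⟩
    ext x
    simp)
  rwa [Set.insert_eq_of_mem] at h
  exact ⟨1, by simp⟩

theorem isOpen_eval_ne_zero (f : MvPolynomial σ ℂ) :
    IsOpen {x : σ → ℂ | MvPolynomial.eval x f ≠ 0} :=
  zarTop_isTopologicalBasis.isOpen ⟨f, rfl⟩

theorem isClosed_eval_eq_zero (f : MvPolynomial σ ℂ) :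
    IsClosed {x : σ → ℂ | MvPolynomial.eval x f = 0} :=
  ⟨by simpa [Set.compl_ofPred] using isOpen_eval_ne_zero f⟩

theorem mem_zariski_closure_iff {s : Set (σ → ℂ)} {x : σ → ℂ} :
    x ∈ closure s ↔
      ∀ f : MvPolynomial σ ℂ, MvPolynomial.eval x f ≠ 0 → ∃ y ∈ s, MvPolynomial.eval y f ≠ 0 := by
  rw [zarTop_isTopologicalBasis.mem_closure_iff]
  constructor
  · intro h f hf
    obtain ⟨y, hy, hys⟩ := h _ ⟨f, rfl⟩ hf
    exact ⟨y, hys, hy⟩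
  · rintro h _ ⟨f, rfl⟩ hx
    obtain ⟨y, hys, hy⟩ := h f hx
    exact ⟨y, hy, hys⟩

/-- The morphism of affine spaces given by a family of polynomials. -/
noncomputable def polyMap (p : σ → MvPolynomial τ ℂ) (y : τ → ℂ) : σ → ℂ :=
  fun i => MvPolynomial.eval y (p i)

theorem eval_polyMap (p : σ → MvPolynomial τ ℂ) (y : τ → ℂ) (f : MvPolynomial σ ℂ) :
    MvPolynomial.eval (polyMap p y) f = MvPolynomial.eval y (MvPolynomial.bind₁ p f) :=
  (MvPolynomial.eval₂Hom_bind₁ (RingHom.id ℂ) y p f).symm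

theorem continuous_polyMap (p : σ → MvPolynomial τ ℂ) : Continuous (polyMap p) := by
  refine continuous_generateFrom_iff.2 ?_
  rintro _ ⟨f, rfl⟩
  simpa only [Set.preimage_ofPred_eq, eval_polyMap] using isOpen_eval_ne_zero _

theorem exists_eval_ne_zero {f : MvPolynomial σ ℂ} (hf : f ≠ 0) :
    ∃ x, MvPolynomial.eval x f ≠ 0 := by
  by_contra! h
  exact hf (MvPolynomial.funext fun x => by simpa using h x)

instance zarTop_irreducibleSpace : IrreducibleSpace (σ → ℂ) where
  toNonempty := ⟨0⟩
  isPreirreducible_univ := by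
    rintro U V hU hV ⟨x, -, hx⟩ ⟨y, -, hy⟩
    obtain ⟨_, ⟨f, rfl⟩, hxf, hf⟩ :=
      zarTop_isTopologicalBasis.exists_subset_of_mem_open hx hU
    obtain ⟨_, ⟨g, rfl⟩, hyg, hg⟩ :=
      zarTop_isTopologicalBasis.exists_subset_of_mem_open hy hV
    have hf0 : f ≠ 0 := by rintro rfl; simp at hxf
    have hg0 : g ≠ 0 := by rintro rfl; simp at hyg
    obtain ⟨z, hz⟩ := exists_eval_ne_zero (mul_ne_zero hf0 hg0)
    rw [map_mul] at hz
    exact ⟨z, trivial, hf (left_ne_zero_of_mul hz), hg (right_ne_zero_of_mul hz)⟩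

theorem isIrreducible_range_of_continuous {X Y : Type*} [TopologicalSpace X] [TopologicalSpace Y]
    [IrreducibleSpace X] {f : X → Y} (hf : Continuous f) : IsIrreducible (Set.range f) := by
  rw [← Set.image_univ]
  exact (IrreducibleSpace.isIrreducible_univ X).image f hf.continuousOn

/-- The ideal of polynomials vanishing on a subset of a subspace of affine space. -/
def subspaceVanishingIdeal {Z : Set (σ → ℂ)} (W : Set Z) : Ideal (MvPolynomial σ ℂ) where
  carrier := {f | ∀ z ∈ W, MvPolynomial.eval z.1 f = 0}
  add_mem' hf hg z hz := by rw [map_add, hf z hz, hg z hz, add_zero]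
  zero_mem' z _ := map_zero _
  smul_mem' a f hf z hz := by rw [smul_eq_mul, map_mul, hf z hz, mul_zero]

theorem isClosed_subspace_eval_eq_zero {Z : Set (σ → ℂ)} (f : MvPolynomial σ ℂ) :
    IsClosed {z : Z | MvPolynomial.eval z.1 f = 0} :=
  (isClosed_eval_eq_zero f).preimage continuous_subtype_val

theorem isPrime_subspaceVanishingIdeal {Z : Set (σ → ℂ)} {W : Set Z} (hW : IsIrreducible W) :
    (subspaceVanishingIdeal W).IsPrime := by
  refine Ideal.isPrime_iff.2 ⟨fun h => ?_, fun {f g} hfg => ?_⟩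
  · obtain ⟨z, hz⟩ := hW.nonempty
    have := (Ideal.eq_top_iff_one _).1 h z hz
    simp at this
  · refine isPreirreducible_iff_isClosed_union_isClosed.1 hW.isPreirreducible _ _
      (isClosed_subspace_eval_eq_zero f) (isClosed_subspace_eval_eq_zero g) fun z hz => ?_
    have := hfg z hz
    rwa [map_mul, mul_eq_zero] at this

theorem subset_of_subspaceVanishingIdeal_le {Z : Set (σ → ℂ)} {W W' : Set Z} (hW : IsClosed W)
    (h : subspaceVanishingIdeal W ≤ subspaceVanishingIdeal W') : W' ⊆ W := by
  intro z hz
  rw [← hW.closure_eq, Topology.IsInducing.subtypeVal.closure_eq_preimage_closure_image,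
    Set.mem_preimage, mem_zariski_closure_iff]
  intro f hf
  by_contra! hy
  exact hf (h (fun w hw => hy _ ⟨w, hw, rfl⟩) z hz)

theorem topologicalKrullDim_le_ringKrullDim_quotient (Z : Set (σ → ℂ))
    (I : Ideal (MvPolynomial σ ℂ)) (hI : ∀ f ∈ I, ∀ z ∈ Z, MvPolynomial.eval z f = 0) :
    topologicalKrullDim Z ≤ ringKrullDim (MvPolynomial σ ℂ ⧸ I) := by
  rw [ringKrullDim_quotient, ← Order.krullDim_orderDual]
  refine Order.krullDim_le_of_strictMono
    (fun W : TopologicalSpace.IrreducibleCloseds Z => OrderDual.toDual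
      (⟨⟨subspaceVanishingIdeal (W : Set Z), isPrime_subspaceVanishingIdeal W.isIrreducible⟩,
        fun f hf z _ => hI f hf z.1 z.2⟩ : PrimeSpectrum.zeroLocus (I : Set (MvPolynomial σ ℂ))))
    fun W W' h => ?_
  rw [OrderDual.toDual_lt_toDual]
  refine lt_of_le_not_ge (fun f hf z hz => hf z (h.le hz)) fun h' => ?_
  exact h.not_ge (subset_of_subspaceVanishingIdeal_le W.isClosed h')

theorem ringKrullDim_le_of_isIntegral {R S : Type*} [CommRing R] [CommRing S] (f : R →+* S)
    (hf : f.IsIntegral) : ringKrullDim S ≤ ringKrullDim R := by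
  algebraize [f]
  refine Order.krullDim_le_of_strictMono (PrimeSpectrum.comap f) fun p q hpq => ?_
  exact Ideal.comap_lt_comap_of_integral_mem_sdiff hpq.le
    (Set.exists_of_ssubset hpq).choose_spec (Algebra.IsIntegral.isIntegral _)

theorem ringKrullDim_quotient_ker_le [Finite σ] [Fintype τ]
    (φ : MvPolynomial σ ℂ →ₐ[ℂ] MvPolynomial τ ℂ) :
    ringKrullDim (MvPolynomial σ ℂ ⧸ RingHom.ker φ) ≤ Fintype.card τ := by
  have : Nontrivial (MvPolynomial σ ℂ ⧸ RingHom.ker φ) :=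
    Ideal.Quotient.nontrivial_iff.2 (RingHom.ker_ne_top φ)
  obtain ⟨s, g, hg, hint⟩ := exists_integral_inj_algHom_of_fg ℂ (MvPolynomial σ ℂ ⧸ RingHom.ker φ)
  have hs : s ≤ Fintype.card τ := by
    have h := trdeg_le_of_injective ((Ideal.kerLiftAlg φ).comp g)
      ((Ideal.kerLiftAlg_injective φ).comp hg)
    rw [MvPolynomial.trdeg_of_isDomain, MvPolynomial.trdeg_of_isDomain] at h
    simpa using h
  refine (ringKrullDim_le_of_isIntegral g.toRingHom hint).trans ?_
  rw [MvPolynomial.ringKrullDim_of_isNoetherianRing]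
  simpa using hs

theorem topologicalKrullDim_closure_range_le [Finite σ] [Fintype τ] (p : σ → MvPolynomial τ ℂ) :
    topologicalKrullDim (closure (Set.range (polyMap p))) ≤ Fintype.card τ := by
  refine (topologicalKrullDim_le_ringKrullDim_quotient _ (RingHom.ker (MvPolynomial.bind₁ p))
    fun f hf z hz => ?_).trans (ringKrullDim_quotient_ker_le _)
  refine closure_minimal ?_ (isClosed_eval_eq_zero f) hz
  rintro _ ⟨y, rfl⟩
  rw [Set.mem_ofPred_eq, eval_polyMap, (RingHom.mem_ker).1 hf, map_zero]

/-- The projection of `n`-space onto the affine subspace through `a` spanned by the first `k`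
coordinate directions. -/
noncomputable def flagProj {n : ℕ} (e : τ ≃ Fin n) (a : τ → ℂ) (k : ℕ) :
    τ → MvPolynomial τ ℂ :=
  fun i => if (e i : ℕ) < k then MvPolynomial.X i else MvPolynomial.C (a i)

theorem polyMap_flagProj {n : ℕ} (e : τ ≃ Fin n) (a : τ → ℂ) (k : ℕ) (y : τ → ℂ) (i : τ) :
    polyMap (flagProj e a k) y i = if (e i : ℕ) < k then y i else a i := by
  unfold polyMap flagProj
  split_ifs <;> simp

theorem le_topologicalKrullDim_closure_range [Fintype τ] (p : σ → MvPolynomial τ ℂ)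
    (F : MvPolynomial σ ℂ) (g : τ → MvPolynomial σ ℂ)
    (hg : ∀ y i, MvPolynomial.eval (polyMap p y) (g i) =
      y i * MvPolynomial.eval (polyMap p y) F)
    (hF : ∃ y, MvPolynomial.eval (polyMap p y) F ≠ 0) :
    Fintype.card τ ≤ topologicalKrullDim (closure (Set.range (polyMap p))) := by
  obtain ⟨a, ha⟩ := hF
  let e := Fintype.equivFin τ
  let φ : ℕ → (τ → ℂ) → closure (Set.range (polyMap p)) := fun k y =>
    ⟨polyMap p (polyMap (flagProj e a k) y), subset_closure ⟨_, rfl⟩⟩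
  have hφ : ∀ k, Continuous (φ k) := fun k =>
    ((continuous_polyMap p).comp (continuous_polyMap _)).subtype_mk _
  have hmono : ∀ k, Set.range (φ k) ⊆ Set.range (φ (k + 1)) := by
    rintro k _ ⟨y, rfl⟩
    refine ⟨polyMap (flagProj e a k) y, Subtype.ext (congrArg (polyMap p) (funext fun i => ?_))⟩
    simp only [polyMap_flagProj]
    split_ifs <;> first | rfl | omega
  refine Order.le_krullDim_iff.2 ⟨LTSeries.mk (Fintype.card τ) (fun k =>
    ⟨closure (Set.range (φ k)), (isIrreducible_range_of_continuous (hφ k)).closure,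
      isClosed_closure⟩) (Fin.strictMono_iff_lt_succ.2 fun k =>
        lt_of_le_not_ge ?_ fun hle => ?_), rfl⟩
  · exact closure_mono (hmono k)
  set i := e.symm k with hi
  have hik : (e i : ℕ) = k := by simp [hi]
  have hvan : Set.range (φ (k + 1)) ⊆
      {z | MvPolynomial.eval z.1 (g i - MvPolynomial.C (a i) * F) = 0} := by
    refine subset_closure.trans (Set.Subset.trans (b := closure (Set.range (φ k))) ?_ ?_)
    · exact hle
    · refine closure_minimal ?_ (isClosed_subspace_eval_eq_zero _)
      rintro _ ⟨y, rfl⟩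
      simp [φ, hg, polyMap_flagProj, hik]
  have hF0 : MvPolynomial.bind₁ (flagProj e a (k + 1)) (MvPolynomial.bind₁ p F) ≠ 0 := by
    intro h0
    apply ha
    have : polyMap (flagProj e a (k + 1)) a = a := funext fun j => by simp [polyMap_flagProj]
    rw [eval_polyMap, ← this, eval_polyMap, h0, map_zero]
  have hX : (MvPolynomial.X i - MvPolynomial.C (a i) : MvPolynomial τ ℂ) ≠ 0 := fun h0 => by
    simpa using congrArg (MvPolynomial.eval fun _ => a i + 1) h0
  obtain ⟨y, hy⟩ := exists_eval_ne_zero (mul_ne_zero hF0 hX)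
  rw [map_mul, ← eval_polyMap, ← eval_polyMap] at hy
  have h := hvan ⟨y, rfl⟩
  simp only [φ, Set.mem_ofPred_eq, map_sub, map_mul, hg, MvPolynomial.eval_C, polyMap_flagProj, hik,
    Nat.lt_succ_self, if_true, ← sub_mul] at h
  rcases mul_eq_zero.1 h with h | h
  · exact right_ne_zero_of_mul hy (by simpa using h)
  · exact left_ne_zero_of_mul hy h

end ZariskiTopology

section LinearAlgebra

open Polynomial

theorem functional_eq_zero_of_stable (n : ℕ) : ∀ {V : Type} [AddCommGroup V] [Module ℂ V]
    [FiniteDimensional ℂ V], Module.finrank ℂ V = n → ∀ (A B : Module.End ℂ V) (v : V)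
    (J : Module.Dual ℂ V), (∀ x, A (B x) - B (A x) + J x • v = 0) →
    (∀ S : Submodule ℂ V, S.map A ≤ S → S.map B ≤ S → v ∈ S → S = ⊤) → J = 0 := by
  induction n using Nat.strong_induction_on with
  | _ n ih =>
  intro V _ _ _ hn A B v J hcomm hst
  rcases subsingleton_or_nontrivial V with hV | hV
  · exact LinearMap.ext fun x => by rw [Subsingleton.elim x 0, map_zero, map_zero]
  obtain ⟨μ, hμ⟩ := Module.End.exists_eigenvalue A
  have hK0 : Module.End.eigenspace A μ ≠ ⊥ := hμ
  have hBA : ∀ x, B (A x) = A (B x) + J x • v := fun x => by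
    have := hcomm x
    rw [sub_add_eq_add_sub, sub_eq_zero] at this
    exact this.symm
  by_cases hJ : Module.End.eigenspace A μ ≤ LinearMap.ker J
  · set K := Module.End.eigenspace A μ with hK
    have hAK : K ≤ K.comap A := fun x hx => by
      rw [Submodule.mem_comap, Module.End.mem_eigenspace_iff.1 hx]
      exact K.smul_mem μ hx
    have hBK : K ≤ K.comap B := fun x hx => by
      have h := hBA x
      rw [LinearMap.mem_ker.1 (hJ hx), zero_smul, add_zero, Module.End.mem_eigenspace_iff.1 hx,
        map_smul] at h
      exact Module.End.mem_eigenspace_iff.2 h.symm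
    have hlt : Module.finrank ℂ (V ⧸ K) < n := by
      have h := K.finrank_quotient_add_finrank
      have : Nontrivial K := Submodule.nontrivial_iff_ne_bot.2 hK0
      have h' : 0 < Module.finrank ℂ K := Module.finrank_pos
      omega
    have h0 := ih _ hlt rfl (K.mapQ K A hAK) (K.mapQ K B hBK) (K.mkQ v) (K.liftQ J hJ)
      (fun x => by
        obtain ⟨x, rfl⟩ := K.mkQ_surjective x
        simpa using congrArg K.mkQ (hcomm x))
      (fun S hA hB hv => by
        have := hst (S.comap K.mkQ)
          (Submodule.map_le_iff_le_comap.2 fun x hx => hA ⟨_, hx, by simp⟩)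
          (Submodule.map_le_iff_le_comap.2 fun x hx => hB ⟨_, hx, by simp⟩) hv
        exact Submodule.comap_injective_of_surjective K.mkQ_surjective (this.trans rfl))
    rw [← K.liftQ_mkQ J hJ, h0, LinearMap.zero_comp]
  · exfalso
    obtain ⟨x, hx, hJx⟩ := SetLike.not_le_iff_exists.1 hJ
    rw [LinearMap.mem_ker] at hJx
    rw [Module.End.mem_eigenspace_iff] at hx
    set N : Module.End ℂ V := A - algebraMap ℂ _ μ with hN
    have hNx : ∀ y, N y = A y - μ • y := fun y => by simp [hN]
    have hv : v ∈ LinearMap.range N := by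
      refine ⟨-(J x)⁻¹ • B x, ?_⟩
      have h := hBA x
      rw [hx, map_smul] at h
      rw [map_smul, hNx, h, sub_add_cancel_left, smul_neg, neg_smul, neg_neg, smul_smul,
        inv_mul_cancel₀ hJx, one_smul]
    have htop := hst (LinearMap.range N)
      (by
        rintro _ ⟨_, ⟨y, rfl⟩, rfl⟩
        exact ⟨A y, by simp [hNx]⟩)
      (by
        rintro _ ⟨_, ⟨y, rfl⟩, rfl⟩
        have : B (N y) = N (B y) + J y • v := by
          rw [hNx, hNx, map_sub, hBA, map_smul]; abel
        rw [this]
        exact add_mem ⟨_, rfl⟩ (Submodule.smul_mem _ _ hv)) hv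
    rw [← LinearMap.ker_eq_bot_iff_range_eq_top] at htop
    exact hK0 (by rw [Module.End.eigenspace_def]; exact htop)

theorem exists_X_sub_C_pow_mem_span_pow {p : ℂ[X]} (hp : Irreducible p) (e : ℕ) :
    ∃ a : ℂ, (X - C a) ^ e ∈ Ideal.span {p ^ e} := by
  obtain ⟨a, ha⟩ := IsAlgClosed.exists_root p (degree_pos_of_irreducible hp).ne'
  refine ⟨a, Ideal.mem_span_singleton.2 (pow_dvd_pow_of_dvd ?_ e)⟩
  exact ((irreducible_X_sub_C a).associated_of_dvd hp (dvd_iff_isRoot.2 ha)).symm.dvd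

/-- The algebra `∏ ℂ[X] ⧸ I i` is generated by one element as soon as each `I i` contains a power
of a linear polynomial. -/
theorem exists_aeval_surjective_pi {ι : Type} [Finite ι] (I : ι → Ideal ℂ[X]) (a : ι → ℂ)
    (e : ι → ℕ) (h : ∀ i, (X - C (a i)) ^ e i ∈ I i) :
    ∃ r : ∀ i, ℂ[X] ⧸ I i, Function.Surjective (aeval r : ℂ[X] →ₐ[ℂ] ∀ i, ℂ[X] ⧸ I i) := by
  obtain ⟨n, ⟨ε⟩⟩ := Finite.exists_equiv_fin ι
  let b : ι → ℂ := fun i => (ε i : ℕ)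
  have hb : Function.Injective b := fun i j hij => ε.injective (Fin.ext (Nat.cast_injective hij))
  let q : ι → ℂ[X] := fun i => X - C (a i) + C (b i)
  refine ⟨fun i => Ideal.Quotient.mk (I i) (q i), fun y => ?_⟩
  have haeval : ∀ i (f : ℂ[X]), aeval (Ideal.Quotient.mk (I i) (q i)) f =
      Ideal.Quotient.mk (I i) (f.comp (q i)) := fun i f => by
    rw [comp_eq_aeval]
    exact aeval_algHom_apply (Ideal.Quotient.mkₐ ℂ (I i)) (q i) f
  choose g hg using fun i => Ideal.Quotient.mk_surjective (y i)
  obtain ⟨f, hf⟩ := Ideal.exists_forall_sub_mem_ideal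
    (I := fun i => Ideal.span {(X - C (b i)) ^ e i})
    (fun i j hij => by
      rw [Function.onFun, Ideal.isCoprime_span_singleton_iff]
      exact (pairwise_coprime_X_sub_C hb hij).pow)
    (fun i => (g i).comp (X + C (a i) - C (b i)))
  refine ⟨f, funext fun i => ?_⟩
  have hpi : (aeval (fun i => Ideal.Quotient.mk (I i) (q i)) f : ∀ i, ℂ[X] ⧸ I i) i =
      aeval (Ideal.Quotient.mk (I i) (q i)) f :=
    (aeval_algHom_apply (Pi.evalAlgHom ℂ (fun i => ℂ[X] ⧸ I i) i) _ f).symm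
  rw [hpi, haeval, ← hg i, Ideal.Quotient.eq]
  obtain ⟨w, hw⟩ := Ideal.mem_span_singleton.1 (hf i)
  have hcomp := congrArg (fun u : ℂ[X] => u.comp (q i)) hw
  have hq : X - C (a i) + C (b i) + C (a i) - C (b i) = (X : ℂ[X]) := by ring
  simp only [sub_comp, mul_comp, pow_comp, comp_assoc, add_comp, X_comp, C_comp, q,
    add_sub_cancel_right, hq, comp_X] at hcomp
  rw [hcomp]
  exact Ideal.mul_mem_right _ _ (h i)

theorem exists_commute_cyclic {V : Type} [AddCommGroup V] [Module ℂ V] [FiniteDimensional ℂ V]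
    (B : Module.End ℂ V) :
    ∃ (R : Module.End ℂ V) (v : V), Commute R B ∧ ∀ x, ∃ f : ℂ[X], aeval R f v = x := by
  obtain ⟨ι, _, p, hp, e, ⟨E⟩⟩ :=
    Module.equiv_directSum_of_isTorsion (Module.AEval.isTorsion_of_finiteDimensional ℂ V B)
  classical
  choose a ha using fun i => exists_X_sub_C_pow_mem_span_pow (hp i) (e i)
  obtain ⟨r, hr⟩ := exists_aeval_surjective_pi (fun i => Ideal.span {p i ^ e i}) a e ha
  let E' : Module.AEval' B ≃ₗ[ℂ[X]] ∀ i, ℂ[X] ⧸ Ideal.span {p i ^ e i} :=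
    E.trans (DirectSum.linearEquivFunOnFintype ℂ[X] ι _)
  let L : V ≃ₗ[ℂ] ∀ i, ℂ[X] ⧸ Ideal.span {p i ^ e i} :=
    (Module.AEval'.of B).trans (E'.restrictScalars ℂ)
  have hLB : ∀ x, L (B x) = (X : ℂ[X]) • L x := fun x => by
    simp only [L, LinearEquiv.trans_apply, LinearEquiv.restrictScalars_apply, ← map_smul,
      Module.AEval'.X_smul_of]
  let R : Module.End ℂ V := L.symm.conj (LinearMap.mulLeft ℂ r)
  have hLR : ∀ x, L (R x) = r * L x := fun x => by simp [R, LinearEquiv.conj_apply]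
  have hLf : ∀ (f : ℂ[X]) x, L (aeval R f x) = aeval r f * L x := fun f x => by
    induction f using Polynomial.induction_on' with
    | add f g hf hg => simp [add_mul, hf, hg]
    | monomial n c =>
      have : ∀ n, L ((R ^ n) x) = r ^ n * L x := fun n => by
        induction n with
        | zero => simp
        | succ n ih => rw [pow_succ', Module.End.mul_apply, hLR, ih, pow_succ', mul_assoc]
      simp [aeval_monomial, this, ← Algebra.smul_def]
  refine ⟨R, L.symm 1, LinearMap.ext fun x => L.injective ?_, fun x => ?_⟩
  · rw [Module.End.mul_apply, Module.End.mul_apply, hLR, hLB, hLB, hLR, mul_smul_comm]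
  · obtain ⟨f, hf⟩ := hr (L x)
    exact ⟨f, L.injective (by rw [hLf, hf, L.apply_symm_apply, mul_one])⟩

end LinearAlgebra

section Krylov

/-- The matrix with columns `v, A v, A² v, …`. -/
def krylov {R : Type*} [CommRing R] {c : ℕ} (A : Matrix (Fin c) (Fin c) R) (v : Fin c → R) :
    Matrix (Fin c) (Fin c) R :=
  Matrix.of fun i k => ((A ^ (k : ℕ)).mulVec v) i

theorem krylov_map {R S : Type*} [CommRing R] [CommRing S] {c : ℕ} (f : R →+* S)
    (A : Matrix (Fin c) (Fin c) R) (v : Fin c → R) :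
    (krylov A v).map f = krylov (A.map f) (f ∘ v) := by
  ext i k
  simp only [krylov, Matrix.map_apply, Matrix.of_apply, RingHom.map_mulVec]
  rw [← RingHom.mapMatrix_apply, ← RingHom.mapMatrix_apply, map_pow]

theorem krylov_mulVec {R : Type*} [CommRing R] {c : ℕ} (A : Matrix (Fin c) (Fin c) R)
    (v p : Fin c → R) :
    (krylov A v).mulVec p = (∑ k : Fin c, p k • A ^ (k : ℕ)).mulVec v := by
  ext i
  simp only [Matrix.sum_mulVec, Matrix.smul_mulVec, Finset.sum_apply, Pi.smul_apply, smul_eq_mul]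
  simp only [Matrix.mulVec, dotProduct, krylov, Matrix.of_apply, mul_comm]

theorem commute_sum_smul_pow {R : Type*} [CommRing R] {c : ℕ} (A : Matrix (Fin c) (Fin c) R)
    (p : Fin c → R) : Commute A (∑ k : Fin c, p k • A ^ (k : ℕ)) :=
  Commute.sum_right _ _ _ fun _ _ => ((Commute.refl A).pow_right _).smul_right _

variable {c : ℕ}

theorem mul_krylov_of_commute {A B P : Matrix (Fin c) (Fin c) ℂ} {v : Fin c → ℂ}
    (hB : Commute A B) (hP : Commute A P) (h : B.mulVec v = P.mulVec v) :
    B * krylov A v = P * krylov A v := by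
  have key : ∀ {M : Matrix (Fin c) (Fin c) ℂ}, Commute A M → ∀ i (k : Fin c),
      (M * krylov A v) i k = ((A ^ (k : ℕ)).mulVec (M.mulVec v)) i := fun {M} hM i k => by
    rw [Matrix.mulVec_mulVec, (hM.pow_left _).eq, ← Matrix.mulVec_mulVec]
    rfl
  ext i k
  rw [key hB, key hP, h]

theorem eq_sum_smul_pow_of_commute {A B : Matrix (Fin c) (Fin c) ℂ} {v : Fin c → ℂ}
    (hB : Commute A B) (h : (krylov A v).det ≠ 0) :
    ∃ p : Fin c → ℂ, B = ∑ k : Fin c, p k • A ^ (k : ℕ) := by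
  have hu : IsUnit (krylov A v) := (Matrix.isUnit_iff_isUnit_det _).2 h.isUnit
  obtain ⟨p, hp⟩ := Matrix.mulVec_surjective_iff_isUnit.2 hu (B.mulVec v)
  rw [krylov_mulVec] at hp
  exact ⟨p, hu.mul_left_injective
    (mul_krylov_of_commute hB (commute_sum_smul_pow A p) hp.symm)⟩

theorem eq_top_of_invariant_of_krylov {A : Matrix (Fin c) (Fin c) ℂ} {v : Fin c → ℂ}
    (h : (krylov A v).det ≠ 0) {S : Submodule ℂ (Fin c → ℂ)}
    (hA : S.map A.mulVecLin ≤ S) (hv : v ∈ S) : S = ⊤ := by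
  have hpow : ∀ k : ℕ, (A ^ k).mulVec v ∈ S := fun k => by
    induction k with
    | zero => simpa using hv
    | succ k ih =>
      rw [pow_succ', ← Matrix.mulVec_mulVec]
      exact hA ⟨_, ih, rfl⟩
  refine eq_top_iff.2 fun x _ => ?_
  obtain ⟨p, rfl⟩ := Matrix.mulVec_surjective_iff_isUnit.2
    ((Matrix.isUnit_iff_isUnit_det _).2 h.isUnit) x
  simp only [krylov_mulVec, Matrix.sum_mulVec, Matrix.smul_mulVec]
  exact sum_mem fun k _ => S.smul_mem _ (hpow k)

theorem exists_commute_krylov_det_ne_zero (B : Matrix (Fin c) (Fin c) ℂ) :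
    ∃ (R : Matrix (Fin c) (Fin c) ℂ) (v : Fin c → ℂ), Commute R B ∧ (krylov R v).det ≠ 0 := by
  obtain ⟨R, v, hRB, hcyc⟩ := exists_commute_cyclic (Matrix.toLinAlgEquiv' B)
  set M := Matrix.toLinAlgEquiv'.symm R with hM
  have hR : R = Matrix.toLinAlgEquiv' M := by simp [hM]
  refine ⟨M, v, ?_, ?_⟩
  · have := hRB.map Matrix.toLinAlgEquiv'.symm
    rwa [AlgEquiv.symm_apply_apply] at this
  · refine IsUnit.ne_zero ((Matrix.isUnit_iff_isUnit_det _).1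
      (Matrix.mulVec_surjective_iff_isUnit.1 fun x => ?_))
    obtain ⟨f, hf⟩ := hcyc x
    have hlt := Polynomial.degree_modByMonic_lt f M.charpoly_monic
    rw [Matrix.charpoly_degree_eq_dim, Fintype.card_fin] at hlt
    refine ⟨fun k => (f %ₘ M.charpoly).coeff k, ?_⟩
    rw [krylov_mulVec, Fin.sum_univ_eq_sum_range fun k => (f %ₘ M.charpoly).coeff k • M ^ k,
      ← hf, hR, Polynomial.aeval_algHom_apply, M.aeval_eq_aeval_mod_charpoly]
    change _ = (Polynomial.aeval M (f %ₘ M.charpoly)).mulVec v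
    congr 1
    rcases eq_or_ne (f %ₘ M.charpoly) 0 with h0 | h0
    · simp [h0]
    · rw [Polynomial.aeval_eq_sum_range' ((Polynomial.natDegree_lt_iff_degree_lt h0).2 hlt)]

end Krylov

section AdhmVariety

attribute [local instance] zarTop

open MvPolynomial

variable {c : ℕ}

theorem mem_adhmVariety_iff_of_vecJ_eq_zero {x : AdhmCoord c → ℂ} (hJ : vecJ x = 0) :
    x ∈ adhmVariety c ↔ Commute (matA x) (matB x) := by
  rw [adhmVariety, Set.mem_ofPred_eq, hJ, Matrix.vecMulVec_zero, add_zero, sub_eq_zero]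
  rfl

theorem mem_adhmVariety_iff_of_vecI_eq_zero {x : AdhmCoord c → ℂ} (hI : vecI x = 0) :
    x ∈ adhmVariety c ↔ Commute (matA x) (matB x) := by
  rw [adhmVariety, Set.mem_ofPred_eq, hI, Matrix.zero_vecMulVec, add_zero, sub_eq_zero]
  rfl

theorem vecJ_eq_zero_of_stablePt {x : AdhmCoord c → ℂ} (hx : x ∈ adhmVariety c)
    (hst : stablePt x) : vecJ x = 0 := by
  have h := functional_eq_zero_of_stable _ rfl (matA x).mulVecLin (matB x).mulVecLin (vecI x)
    (dotProductBilin ℂ ℂ (vecJ x)) (fun y => by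
      have := congrArg (fun M => Matrix.mulVec M y) hx
      simpa [Matrix.add_mulVec, Matrix.sub_mulVec, Matrix.vecMulVec_mulVec] using this) hst
  funext i
  simpa using LinearMap.congr_fun h (Pi.single i 1)

/-- The generic matrix `A`. -/
noncomputable def genA (c : ℕ) : Matrix (Fin c) (Fin c) (MvPolynomial (AdhmCoord c) ℂ) :=
  Matrix.of fun i j => X (Sum.inl (i, j))

/-- The generic matrix `B`. -/
noncomputable def genB (c : ℕ) : Matrix (Fin c) (Fin c) (MvPolynomial (AdhmCoord c) ℂ) :=
  Matrix.of fun i j => X (Sum.inr (Sum.inl (i, j)))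

/-- The generic vector `I`. -/
noncomputable def genI (c : ℕ) : Fin c → MvPolynomial (AdhmCoord c) ℂ :=
  fun i => X (Sum.inr (Sum.inr (Sum.inl i)))

/-- The generic covector `J`. -/
noncomputable def genJ (c : ℕ) : Fin c → MvPolynomial (AdhmCoord c) ℂ :=
  fun i => X (Sum.inr (Sum.inr (Sum.inr i)))

theorem genA_map_eval (x : AdhmCoord c → ℂ) : (genA c).map (eval x) = matA x := by
  ext i j; simp [genA, matA]

theorem genB_map_eval (x : AdhmCoord c → ℂ) : (genB c).map (eval x) = matB x := by
  ext i j; simp [genB, matB]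

theorem eval_comp_genI (x : AdhmCoord c → ℂ) : eval x ∘ genI c = vecI x := by
  ext i; simp [genI, vecI]

theorem isClosed_adhmVariety (c : ℕ) : IsClosed (adhmVariety c) := by
  have : adhmVariety c = ⋂ i, ⋂ j, {x | eval x ((genA c * genB c - genB c * genA c +
      Matrix.vecMulVec (genI c) (genJ c)) i j) = 0} := by
    ext x
    simp only [Set.mem_iInter, Set.mem_ofPred_eq, adhmVariety, ← Matrix.ext_iff]
    simp [Matrix.mul_apply, Matrix.vecMulVec_apply, genA, genB, genI, genJ, matA, matB, vecI, vecJ]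
  rw [this]
  exact isClosed_iInter fun i => isClosed_iInter fun j => isClosed_eval_eq_zero _

theorem isClosed_vecI_eq_zero (c : ℕ) : IsClosed {x : AdhmCoord c → ℂ | vecI x = 0} := by
  have : {x : AdhmCoord c → ℂ | vecI x = 0} = ⋂ i, {x | eval x (genI c i) = 0} := by
    ext x
    simp [funext_iff, vecI, genI]
  rw [this]
  exact isClosed_iInter fun i => isClosed_eval_eq_zero _

theorem isClosed_vecJ_eq_zero (c : ℕ) : IsClosed {x : AdhmCoord c → ℂ | vecJ x = 0} := by
  have : {x : AdhmCoord c → ℂ | vecJ x = 0} = ⋂ i, {x | eval x (genJ c i) = 0} := by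
    ext x
    simp [funext_iff, vecJ, genJ]
  rw [this]
  exact isClosed_iInter fun i => isClosed_eval_eq_zero _

theorem isClosed_adhmVariety_inter_vecI_eq_zero (c : ℕ) :
    IsClosed {x ∈ adhmVariety c | vecI x = 0} :=
  (isClosed_adhmVariety c).inter (isClosed_vecI_eq_zero c)

/-- The determinant of `(I, A I, …, A ^ (c - 1) I)` as a polynomial in the coordinates. -/
noncomputable def cyclicPoly (c : ℕ) : MvPolynomial (AdhmCoord c) ℂ :=
  (krylov (genA c) (genI c)).det

theorem eval_cyclicPoly (x : AdhmCoord c → ℂ) :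
    eval x (cyclicPoly c) = (krylov (matA x) (vecI x)).det := by
  rw [cyclicPoly, RingHom.map_det, RingHom.mapMatrix_apply, krylov_map, genA_map_eval,
    eval_comp_genI]

theorem stablePt_of_eval_cyclicPoly_ne_zero {x : AdhmCoord c → ℂ}
    (hx : eval x (cyclicPoly c) ≠ 0) : stablePt x := fun S hA _ hI => by
  rw [eval_cyclicPoly] at hx
  exact eq_top_of_invariant_of_krylov hx hA hI

/-- The closed subset of commuting pairs with `J = 0`. -/
def commutingLocus (c : ℕ) : Set (AdhmCoord c → ℂ) := {x ∈ adhmVariety c | vecJ x = 0}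

theorem exists_eval_lineMap_ne_zero {σ : Type} (x y : σ → ℂ) {f g : MvPolynomial σ ℂ}
    (hf : eval x f ≠ 0) (hg : eval y g ≠ 0) :
    ∃ t : ℂ, eval (x + t • (y - x)) f ≠ 0 ∧ eval (x + t • (y - x)) g ≠ 0 := by
  let φ : MvPolynomial σ ℂ →ₐ[ℂ] Polynomial ℂ :=
    aeval fun i => Polynomial.C (x i) + Polynomial.X * Polynomial.C (y i - x i)
  have hφ : ∀ t h, (φ h).eval t = eval (x + t • (y - x)) h := fun t h => by
    induction h using MvPolynomial.induction_on with
    | C a => simp [φ]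
    | add p q hp hq => simp [hp, hq]
    | mul_X p i hp => rw [map_mul, Polynomial.eval_mul, hp, map_mul]; simp [φ]
  have hne : φ f * φ g ≠ 0 := by
    refine mul_ne_zero (fun h => hf ?_) fun h => hg ?_
    · simpa [h] using (hφ 0 f).symm
    · simpa [h] using (hφ 1 g).symm
  obtain ⟨t, ht⟩ : ∃ t, (φ f * φ g).eval t ≠ 0 := by
    by_contra! h
    exact hne (Polynomial.funext fun t => by simpa using h t)
  rw [Polynomial.eval_mul, hφ, hφ] at ht
  exact ⟨t, left_ne_zero_of_mul ht, right_ne_zero_of_mul ht⟩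

theorem commutingLocus_subset_closure (c : ℕ) :
    commutingLocus c ⊆ closure {x ∈ commutingLocus c | eval x (cyclicPoly c) ≠ 0} := by
  rintro x ⟨hx, hJ⟩
  rw [mem_zariski_closure_iff]
  intro f hf
  obtain ⟨R, v, hR, hv⟩ := exists_commute_krylov_det_ne_zero (matB x)
  let y : AdhmCoord c → ℂ := Sum.elim (fun ij => R ij.1 ij.2)
    (Sum.elim (fun ij => matB x ij.1 ij.2) (Sum.elim v 0))
  have hy : eval y (cyclicPoly c) ≠ 0 := by rwa [eval_cyclicPoly]
  obtain ⟨t, htf, htc⟩ := exists_eval_lineMap_ne_zero x y hf hy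
  have hJt : vecJ (x + t • (y - x)) = 0 := by
    ext i
    have : x (Sum.inr (Sum.inr (Sum.inr i))) = 0 := congrFun hJ i
    simp [vecJ, y, this]
  have hA : matA (x + t • (y - x)) = matA x + t • (R - matA x) := by
    ext i j
    simp [matA, y]
  have hB : matB (x + t • (y - x)) = matB x := by
    ext i j
    simp [matB, y]
  rw [mem_adhmVariety_iff_of_vecJ_eq_zero hJ] at hx
  refine ⟨_, ⟨⟨(mem_adhmVariety_iff_of_vecJ_eq_zero hJt).2 ?_, hJt⟩, htc⟩, htf⟩
  rw [hA, hB]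
  exact hx.add_left ((hR.sub_left hx).smul_left t)

theorem isClosed_commutingLocus (c : ℕ) : IsClosed (commutingLocus c) :=
  (isClosed_adhmVariety c).inter (isClosed_vecJ_eq_zero c)

theorem closure_stable_eq_commutingLocus (c : ℕ) :
    closure {x ∈ adhmVariety c | stablePt x} = commutingLocus c := by
  refine (closure_minimal ?_ (isClosed_commutingLocus c)).antisymm
    ((commutingLocus_subset_closure c).trans (closure_mono ?_))
  · exact fun x hx => ⟨hx.1, vecJ_eq_zero_of_stablePt hx.1 hx.2⟩
  · exact fun x hx => ⟨hx.1.1, stablePt_of_eval_cyclicPoly_ne_zero hx.2⟩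

/-- Coordinates `(A, p, I)` for the parametrization `(A, p(A), I, 0)` of the commuting locus. -/
abbrev ParamCoord (c : ℕ) : Type := (Fin c × Fin c) ⊕ (Fin c ⊕ Fin c)

/-- The polynomials defining the parametrization `(A, p, I) ↦ (A, p(A), I, 0)`. -/
noncomputable def paramPoly (c : ℕ) : AdhmCoord c → MvPolynomial (ParamCoord c) ℂ :=
  Sum.elim (fun ij => X (Sum.inl ij))
    (Sum.elim
      (fun ij => (∑ k : Fin c, (X (Sum.inr (Sum.inl k)) : MvPolynomial (ParamCoord c) ℂ) •
        (Matrix.of fun i j => X (Sum.inl (i, j)) :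
          Matrix (Fin c) (Fin c) (MvPolynomial (ParamCoord c) ℂ)) ^ (k : ℕ)) ij.1 ij.2)
      (Sum.elim (fun i => X (Sum.inr (Sum.inr i))) 0))

theorem matA_param (y : ParamCoord c → ℂ) :
    matA (polyMap (paramPoly c) y) = Matrix.of fun i j => y (Sum.inl (i, j)) := by
  ext i j; simp [matA, polyMap, paramPoly]

theorem matB_param (y : ParamCoord c → ℂ) : matB (polyMap (paramPoly c) y) =
    ∑ k : Fin c, y (Sum.inr (Sum.inl k)) • matA (polyMap (paramPoly c) y) ^ (k : ℕ) := by
  have hA : (Matrix.of fun i j => X (Sum.inl (i, j)) : Matrix (Fin c) (Fin c)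
      (MvPolynomial (ParamCoord c) ℂ)).map (eval y) = matA (polyMap (paramPoly c) y) := by
    rw [matA_param]; ext i j; simp
  ext i j
  simp only [matB, polyMap, paramPoly, Sum.elim_inr, Sum.elim_inl, Matrix.of_apply,
    Matrix.sum_apply, Matrix.smul_apply, smul_eq_mul, map_sum, map_mul, eval_X]
  refine Finset.sum_congr rfl fun k _ => congrArg _ ?_
  rw [← Matrix.map_apply (f := eval y), ← RingHom.mapMatrix_apply, map_pow,
    RingHom.mapMatrix_apply, hA]
  rfl

theorem vecI_param (y : ParamCoord c → ℂ) :
    vecI (polyMap (paramPoly c) y) = fun i => y (Sum.inr (Sum.inr i)) := by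
  ext i; simp [vecI, polyMap, paramPoly]

theorem vecJ_param (y : ParamCoord c → ℂ) : vecJ (polyMap (paramPoly c) y) = 0 := by
  ext i; simp [vecJ, polyMap, paramPoly]

theorem adhmCoord_ext {x y : AdhmCoord c → ℂ} (hA : matA x = matA y) (hB : matB x = matB y)
    (hI : vecI x = vecI y) (hJ : vecJ x = vecJ y) : x = y := by
  funext s
  rcases s with ⟨i, j⟩ | ⟨i, j⟩ | i | i
  exacts [congrFun (congrFun hA i) j, congrFun (congrFun hB i) j, congrFun hI i, congrFun hJ i]

theorem mem_range_param {x : AdhmCoord c → ℂ} (hx : x ∈ commutingLocus c)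
    (h : eval x (cyclicPoly c) ≠ 0) : x ∈ Set.range (polyMap (paramPoly c)) := by
  obtain ⟨hx, hJ⟩ := hx
  rw [mem_adhmVariety_iff_of_vecJ_eq_zero hJ] at hx
  rw [eval_cyclicPoly] at h
  obtain ⟨p, hp⟩ := eq_sum_smul_pow_of_commute hx h
  let y : ParamCoord c → ℂ := Sum.elim (fun ij => matA x ij.1 ij.2) (Sum.elim p (vecI x))
  have hA : matA (polyMap (paramPoly c) y) = matA x := by rw [matA_param]; rfl
  refine ⟨y, adhmCoord_ext hA ?_ (by rw [vecI_param]; rfl) (by rw [vecJ_param, hJ])⟩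
  rw [matB_param, hA, hp]
  rfl

theorem closure_range_param (c : ℕ) :
    closure (Set.range (polyMap (paramPoly c))) = commutingLocus c := by
  refine (closure_minimal ?_ (isClosed_commutingLocus c)).antisymm
    ((commutingLocus_subset_closure c).trans (closure_mono ?_))
  · rintro _ ⟨y, rfl⟩
    refine ⟨(mem_adhmVariety_iff_of_vecJ_eq_zero (vecJ_param y)).2 ?_, vecJ_param y⟩
    rw [matB_param]
    exact commute_sum_smul_pow _ _
  · exact fun x hx => mem_range_param hx.1 hx.2

theorem isIrreducible_commutingLocus (c : ℕ) : IsIrreducible (commutingLocus c) := by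
  rw [← closure_range_param]
  exact (isIrreducible_range_of_continuous (continuous_polyMap _)).closure

theorem exists_mem_commutingLocus_cyclic (c : ℕ) :
    ∃ x ∈ commutingLocus c, eval x (cyclicPoly c) ≠ 0 :=
  closure_nonempty_iff.1
    ((isIrreducible_commutingLocus c).nonempty.mono (commutingLocus_subset_closure c))

/-- The numerators of the rational inverse of the parametrization, with denominator
`cyclicPoly c`. -/
noncomputable def paramInv (c : ℕ) : ParamCoord c → MvPolynomial (AdhmCoord c) ℂ :=
  Sum.elim (fun ij => genA c ij.1 ij.2 * cyclicPoly c)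
    (Sum.elim ((krylov (genA c) (genI c)).adjugate.mulVec ((genB c).mulVec (genI c)))
      (fun i => genI c i * cyclicPoly c))

theorem eval_paramInv (y : ParamCoord c → ℂ) (s : ParamCoord c) :
    eval (polyMap (paramPoly c) y) (paramInv c s) =
      y s * eval (polyMap (paramPoly c) y) (cyclicPoly c) := by
  rcases s with ⟨i, j⟩ | k | i
  · simp [paramInv, genA, polyMap, paramPoly]
  · set x := polyMap (paramPoly c) y with hx
    have hBI : eval x ∘ ((genB c).mulVec (genI c)) = (matB x).mulVec (vecI x) := by
      funext i
      rw [Function.comp_apply, RingHom.map_mulVec, genB_map_eval, eval_comp_genI]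
    have h : eval x (paramInv c (Sum.inr (Sum.inl k))) =
        ((krylov (matA x) (vecI x)).adjugate.mulVec ((matB x).mulVec (vecI x))) k := by
      simp only [paramInv, Sum.elim_inr, Sum.elim_inl]
      rw [RingHom.map_mulVec, ← RingHom.mapMatrix_apply, RingHom.map_adjugate,
        RingHom.mapMatrix_apply, krylov_map, genA_map_eval, eval_comp_genI, hBI]
    rw [h, hx, matB_param, ← hx, ← krylov_mulVec, Matrix.mulVec_mulVec, Matrix.adjugate_mul,
      eval_cyclicPoly, Matrix.smul_mulVec, Matrix.one_mulVec, Pi.smul_apply, smul_eq_mul, mul_comm]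
  · simp [paramInv, genI, polyMap, paramPoly]

theorem topologicalKrullDim_commutingLocus (c : ℕ) :
    topologicalKrullDim (commutingLocus c) = ((2 * c + c ^ 2 : ℕ) : ℕ∞) := by
  have hcard : Fintype.card (ParamCoord c) = 2 * c + c ^ 2 := by
    simp only [Fintype.card_sum, Fintype.card_prod, Fintype.card_fin]
    ring
  rw [← closure_range_param, ← hcard]
  refine (topologicalKrullDim_closure_range_le _).antisymm
    (le_topologicalKrullDim_closure_range _ (cyclicPoly c) (paramInv c) eval_paramInv ?_)
  obtain ⟨x, hx, hxc⟩ := exists_mem_commutingLocus_cyclic c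
  obtain ⟨y, rfl⟩ := mem_range_param hx hxc
  exact ⟨y, hxc⟩

/-- Exchange of the coordinates of `I` and `J`. -/
def swapIJ (c : ℕ) : AdhmCoord c ≃ AdhmCoord c :=
  Equiv.sumCongr (Equiv.refl _) (Equiv.sumCongr (Equiv.refl _) (Equiv.sumComm _ _))

theorem continuous_comp_swapIJ (c : ℕ) :
    Continuous fun x : AdhmCoord c → ℂ => x ∘ swapIJ c := by
  convert! continuous_polyMap fun i => (X (swapIJ c i) : MvPolynomial (AdhmCoord c) ℂ) using 1
  ext x i
  simp [polyMap]

/-- Exchange of `I` and `J` as a homeomorphism. -/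
def swapIJHomeomorph (c : ℕ) : (AdhmCoord c → ℂ) ≃ₜ (AdhmCoord c → ℂ) where
  toFun x := x ∘ swapIJ c
  invFun x := x ∘ swapIJ c
  left_inv x := by ext (_ | _ | _ | _) <;> rfl
  right_inv x := by ext (_ | _ | _ | _) <;> rfl
  continuous_toFun := continuous_comp_swapIJ c
  continuous_invFun := continuous_comp_swapIJ c

theorem swapIJHomeomorph_preimage_commutingLocus (c : ℕ) :
    swapIJHomeomorph c ⁻¹' commutingLocus c = {x ∈ adhmVariety c | vecI x = 0} := by
  ext x
  constructor
  · exact fun ⟨h, hI⟩ => ⟨(mem_adhmVariety_iff_of_vecI_eq_zero (x := x) hI).2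
      ((mem_adhmVariety_iff_of_vecJ_eq_zero (x := swapIJHomeomorph c x) hI).1 h), hI⟩
  · exact fun ⟨h, hI⟩ => ⟨(mem_adhmVariety_iff_of_vecJ_eq_zero (x := swapIJHomeomorph c x) hI).2
      ((mem_adhmVariety_iff_of_vecI_eq_zero hI).1 h), hI⟩

theorem isIrreducible_vecI_eq_zero (c : ℕ) :
    IsIrreducible {x ∈ adhmVariety c | vecI x = 0} := by
  rw [← swapIJHomeomorph_preimage_commutingLocus, ← Homeomorph.image_symm]
  exact (isIrreducible_commutingLocus c).image _
    (swapIJHomeomorph c).symm.continuous.continuousOn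

theorem topologicalKrullDim_vecI_eq_zero (c : ℕ) :
    topologicalKrullDim {x ∈ adhmVariety c | vecI x = 0} = ((2 * c + c ^ 2 : ℕ) : ℕ∞) := by
  rw [← topologicalKrullDim_commutingLocus]
  exact ((swapIJHomeomorph c).sets
    (swapIJHomeomorph_preimage_commutingLocus c).symm).isHomeomorph.topologicalKrullDim_eq

theorem exists_mem_vecI_eq_zero_vecJ_ne_zero (hc : 1 ≤ c) :
    ∃ x ∈ {x ∈ adhmVariety c | vecI x = 0}, vecJ x ⟨0, hc⟩ ≠ 0 :=
  ⟨Sum.elim 0 (Sum.elim 0 (Sum.elim 0 1)),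
    ⟨(mem_adhmVariety_iff_of_vecI_eq_zero rfl).2 (Commute.zero_left _), rfl⟩, by simp [vecJ]⟩

theorem not_isIrreducible_adhmVariety (hc : 1 ≤ c) : ¬ IsIrreducible (adhmVariety c) := by
  intro h
  obtain ⟨x, hx, hxc⟩ := exists_mem_commutingLocus_cyclic c
  obtain ⟨y, hy, hyJ⟩ := exists_mem_vecI_eq_zero_vecJ_ne_zero hc
  obtain ⟨z, hz, hzc, hzJ⟩ := h.isPreirreducible _ _ (isOpen_eval_ne_zero (cyclicPoly c))
    (isOpen_eval_ne_zero (genJ c ⟨0, hc⟩)) ⟨x, hx.1, hxc⟩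
    ⟨y, hy.1, by simpa [genJ, vecJ] using hyJ⟩
  have := congrFun (vecJ_eq_zero_of_stablePt hz (stablePt_of_eval_cyclicPoly_ne_zero hzc)) ⟨0, hc⟩
  exact hzJ (by simpa [genJ, vecJ] using this)

theorem commutingLocus_ne_vecI_eq_zero (hc : 1 ≤ c) :
    commutingLocus c ≠ {x ∈ adhmVariety c | vecI x = 0} := by
  obtain ⟨y, hy, hyJ⟩ := exists_mem_vecI_eq_zero_vecJ_ne_zero hc
  intro h
  rw [← h] at hy
  exact hyJ (congrFun hy.2 _)

end AdhmVariety

/-- V(1,c) is reducible for c ≥ 1: the closure of the stable locus (which is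
contained in {J = 0}) and the closed subset {I = 0} are two distinct irreducible closed
subsets of V(1,c), both of maximal dimension 2c + c². -/
theorem adhm_variety_rank_one_reducible (c : ℕ) (hc : 1 ≤ c) :
    letI : TopologicalSpace (AdhmCoord c → ℂ) := zarTop (AdhmCoord c)
    closure {x ∈ adhmVariety c | stablePt x} ⊆ adhmVariety c ∧
    closure {x ∈ adhmVariety c | stablePt x} ⊆ {x | vecJ x = 0} ∧
    IsClosed {x ∈ adhmVariety c | vecI x = 0} ∧
    IsIrreducible (closure {x ∈ adhmVariety c | stablePt x}) ∧
    IsIrreducible {x ∈ adhmVariety c | vecI x = 0} ∧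
    closure {x ∈ adhmVariety c | stablePt x} ≠ {x ∈ adhmVariety c | vecI x = 0} ∧
    topologicalKrullDim ↥(closure {x ∈ adhmVariety c | stablePt x}) =
      ((2 * c + c ^ 2 : ℕ) : ℕ∞) ∧
    topologicalKrullDim ↥{x ∈ adhmVariety c | vecI x = 0} =
      ((2 * c + c ^ 2 : ℕ) : ℕ∞) ∧
    ¬ IsIrreducible (adhmVariety c) := by
  rw [closure_stable_eq_commutingLocus]
  exact ⟨fun _ hx => hx.1, fun _ hx => hx.2,
    isClosed_adhmVariety_inter_vecI_eq_zero c, isIrreducible_commutingLocus c,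
    isIrreducible_vecI_eq_zero c, commutingLocus_ne_vecI_eq_zero hc,
    topologicalKrullDim_commutingLocus c, topologicalKrullDim_vecI_eq_zero c,
    not_isIrreducible_adhmVariety hc⟩
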